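/- arXiv:1812.11802 — 2 statements merged into one kernel-verified Lean document; each statement's English description precedes it below -/
import Mathlib

section
/- Let Ω ⊂ ℝ^N (N = 2 or 3) be a nonempty bounded domain. Define S = { w ∈ L²(Ω;ℝ^N) : ∫_Ω [ (w ⊗ w) : ∇²φ − (1/N) |w|² Δφ ] dx = 0 for every φ ∈ C_c^∞(Ω) }. Then S is nowhere dense in L²(Ω;ℝ^N); i.e., the closure of S contains no open ball of L²(Ω;ℝ^N). -/
open MeasureTheory Set Filter Topology

noncomputable section

abbrev Euc (N : ℕ) := EuclideanSpace ℝ (Fin N)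

/-- The Hessian entry `∂_i ∂_j φ (x)`. -/
noncomputable def hessX {N : ℕ} (φ : Euc N → ℝ) (x : Euc N) (i j : Fin N) : ℝ :=
  iteratedFDeriv ℝ 2 φ x ![EuclideanSpace.single i 1, EuclideanSpace.single j 1]

/-- `φ ∈ C_c^∞(Ω)`: smooth, compactly supported, with support inside `Ω`. -/
def IsTestFun {N : ℕ} (Ω : Set (Euc N)) (φ : Euc N → ℝ) : Prop :=
  ContDiff ℝ (⊤ : ℕ∞) φ ∧ HasCompactSupport φ ∧ tsupport φ ⊆ Ω

/-- `∫_Ω [ (w ⊗ w) : ∇²φ − (1/N) |w|² Δφ ] dx`. -/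
noncomputable def Qint {N : ℕ} (Ω : Set (Euc N)) (w : Euc N → Euc N) (φ : Euc N → ℝ) : ℝ :=
  ∫ x in Ω, ((∑ i, ∑ j, w x i * w x j * hessX φ x i j)
    - (1 / (N : ℝ)) * ‖w x‖ ^ 2 * ∑ i, hessX φ x i i)

/-- The set `S ⊆ L²(Ω; ℝ^N)` of those `w` for which the quadratic integral identity holds
for every test function. -/
def Sset {N : ℕ} (Ω : Set (Euc N)) : Set (Lp (Euc N) 2 (volume.restrict Ω)) :=
  {w | ∀ φ : Euc N → ℝ, IsTestFun Ω φ → Qint Ω (⇑w) φ = 0}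

open scoped InnerProductSpace

/-- The deviatoric part of the bilinear form `M`, as an operator on `ℝ^N`. -/
def deviatoric {N : ℕ} (M : ContinuousMultilinearMap ℝ (fun _ : Fin 2 => Euc N) ℝ) :
    Euc N →L[ℝ] Euc N :=
  ∑ i, ∑ j, (M ![EuclideanSpace.single i 1, EuclideanSpace.single j 1]) •
      (EuclideanSpace.proj i : Euc N →L[ℝ] ℝ).smulRight (EuclideanSpace.single j (1 : ℝ))
    - ((1 / (N : ℝ)) * ∑ i, M ![EuclideanSpace.single i 1, EuclideanSpace.single i 1]) •
      ContinuousLinearMap.id ℝ (Euc N)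

lemma continuous_deviatoric {N : ℕ} : Continuous (deviatoric (N := N)) := by
  have heval : ∀ v : Fin 2 → Euc N, Continuous
      fun M : ContinuousMultilinearMap ℝ (fun _ : Fin 2 => Euc N) ℝ => M v :=
    fun v => continuous_eval_const v
  refine Continuous.sub ?_ ?_
  · exact continuous_finsetSum _ fun i _ => continuous_finsetSum _ fun j _ =>
      (heval _).smul continuous_const
  · exact (continuous_const.mul (continuous_finsetSum _ fun i _ => heval _)).smul
      continuous_const

lemma deviatoric_zero {N : ℕ} : deviatoric (0 : ContinuousMultilinearMap ℝ
    (fun _ : Fin 2 => Euc N) ℝ) = 0 := by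
  ext w i
  simp [deviatoric, sum_apply]

lemma inner_deviatoric_self {N : ℕ} (M : ContinuousMultilinearMap ℝ (fun _ : Fin 2 => Euc N) ℝ)
    (w : Euc N) :
    ⟪deviatoric M w, w⟫_ℝ =
      (∑ i, ∑ j, w i * w j * M ![EuclideanSpace.single i 1, EuclideanSpace.single j 1])
        - (1 / (N : ℝ)) * ‖w‖ ^ 2 *
          ∑ i, M ![EuclideanSpace.single i 1, EuclideanSpace.single i 1] := by
  simp only [deviatoric, sub_apply, sum_apply, smul_apply,
    ContinuousLinearMap.smulRight_apply, ContinuousLinearMap.id_apply, inner_sub_left, sum_inner,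
    real_inner_smul_left, real_inner_self_eq_norm_sq, EuclideanSpace.inner_single_left,
    PiLp.proj_apply, map_one, one_mul]
  congr 1
  · refine Finset.sum_congr rfl fun i _ => Finset.sum_congr rfl fun j _ => ?_
    ring
  · ring

/-- `Qint` is the quadratic form of a bounded operator on `L²(Ω; ℝ^N)`. -/
lemma exists_clm_Qint_eq_inner {N : ℕ} {Ω : Set (Euc N)} {φ : Euc N → ℝ} (hφ : IsTestFun Ω φ) :
    ∃ T : Lp (Euc N) 2 (volume.restrict Ω) →L[ℝ] Lp (Euc N) 2 (volume.restrict Ω),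
      ∀ w : Lp (Euc N) 2 (volume.restrict Ω), Qint Ω (⇑w) φ = ⟪T w, w⟫_ℝ := by
  obtain ⟨hsmooth, hcomp, -⟩ := hφ
  have hcont₂ : Continuous (iteratedFDeriv ℝ 2 φ) :=
    (contDiff_infty.mp hsmooth 2).continuous_iteratedFDeriv (m := 2) le_rfl
  have hcont : Continuous fun x => deviatoric (iteratedFDeriv ℝ 2 φ x) :=
    continuous_deviatoric.comp hcont₂
  have hsupp : HasCompactSupport fun x => deviatoric (iteratedFDeriv ℝ 2 φ x) :=
    HasCompactSupport.comp_left (g := deviatoric) (hcomp.iteratedFDeriv (𝕜 := ℝ) 2)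
      deviatoric_zero
  obtain ⟨C, hC⟩ := hsupp.exists_bound_of_continuous hcont
  have hA : MemLp (fun x => deviatoric (iteratedFDeriv ℝ 2 φ x)) ⊤ (volume.restrict Ω) :=
    memLp_top_of_bound hcont.aestronglyMeasurable C (Eventually.of_forall hC)
  let B := ContinuousLinearMap.id ℝ (Euc N →L[ℝ] Euc N)
  refine ⟨B.holderL (volume.restrict Ω) ⊤ 2 2 hA.toLp, fun w => ?_⟩
  rw [L2.inner_def, Qint]
  refine integral_congr_ae ?_
  filter_upwards [B.coeFn_holder (r := 2) hA.toLp w, hA.coeFn_toLp] with x hx hx'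
  rw [ContinuousLinearMap.holderL_apply_apply, hx, hx']
  exact (inner_deviatoric_self _ _).symm

/-- A continuous quadratic form vanishing on a set vanishes everywhere as soon as the closure of
the set contains a ball. -/
lemma inner_self_eq_zero_of_ball_subset_closure {H : Type*} [NormedAddCommGroup H]
    [InnerProductSpace ℝ H] (T : H →L[ℝ] H) {S : Set H} (hS : ∀ w ∈ S, ⟪T w, w⟫_ℝ = 0)
    {w₀ : H} {r : ℝ} (hr : 0 < r) (hball : Metric.ball w₀ r ⊆ closure S) (v : H) :
    ⟪T v, v⟫_ℝ = 0 := by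
  have hclosed : IsClosed {w | ⟪T w, w⟫_ℝ = 0} :=
    isClosed_eq (T.continuous.inner continuous_id) continuous_const
  have hzero : ∀ w ∈ Metric.ball w₀ r, ⟪T w, w⟫_ℝ = 0 := fun w hw =>
    closure_minimal hS hclosed (hball hw)
  obtain ⟨t, ht, htv⟩ : ∃ t : ℝ, 0 < t ∧ t * ‖v‖ < r := by
    refine ⟨r / (‖v‖ + 1), by positivity, ?_⟩
    rw [div_mul_eq_mul_div, div_lt_iff₀ (by positivity)]
    nlinarith
  have hnorm : ‖t • v‖ < r := by rwa [norm_smul, Real.norm_of_nonneg ht.le]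
  have h₀ := hzero w₀ (Metric.mem_ball_self hr)
  have h₁ := hzero (w₀ + t • v) (by simpa [dist_eq_norm] using hnorm)
  have h₂ := hzero (w₀ - t • v) (by simpa [dist_eq_norm] using hnorm)
  simp only [map_add, map_sub, map_smul, inner_add_left, inner_add_right, inner_sub_left,
    inner_sub_right, real_inner_smul_left, real_inner_smul_right] at h₁ h₂
  have h : t ^ 2 * ⟪T v, v⟫_ℝ = 0 := by linear_combination (h₁ + h₂) / 2 - h₀
  exact (mul_eq_zero.mp h).resolve_left (by positivity)

lemma hessX_coord_sq {N : ℕ} (k i j : Fin N) (x : Euc N) :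
    hessX (fun y : Euc N => y k ^ 2) x i j =
      2 * (if k = i then 1 else 0) * (if k = j then 1 else 0) := by
  have hderiv : ∀ y : Euc N, HasFDerivAt (fun y : Euc N => y k ^ 2)
      ((2 * y k) • (EuclideanSpace.proj k : Euc N →L[ℝ] ℝ)) y := fun y => by
    simpa using (EuclideanSpace.proj k : Euc N →L[ℝ] ℝ).hasFDerivAt.pow (x := y) 2
  have hderiv₂ : HasFDerivAt
      (fun y : Euc N => (2 * y k) • (EuclideanSpace.proj k : Euc N →L[ℝ] ℝ))
      (((2 : ℝ) • (EuclideanSpace.proj k : Euc N →L[ℝ] ℝ)).smulRight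
        (EuclideanSpace.proj k : Euc N →L[ℝ] ℝ)) x :=
    ((EuclideanSpace.proj k : Euc N →L[ℝ] ℝ).hasFDerivAt.const_mul 2).smul_const
      (EuclideanSpace.proj k : Euc N →L[ℝ] ℝ)
  rw [hessX, iteratedFDeriv_two_apply, funext fun y => (hderiv y).fderiv, hderiv₂.fderiv]
  split_ifs <;> simp_all

/-- Near every point of an open set, `y ↦ y_k²` coincides with a test function. -/
lemma exists_isTestFun_hessX_eq {N : ℕ} {Ω : Set (Euc N)} (hΩ : IsOpen Ω) {p : Euc N}
    (hp : p ∈ Ω) (k : Fin N) :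
    ∃ φ : Euc N → ℝ, IsTestFun Ω φ ∧ ∃ ρ > 0, Metric.ball p ρ ⊆ Ω ∧
      ∀ x ∈ Metric.ball p ρ, ∀ i j,
        hessX φ x i j = 2 * (if k = i then 1 else 0) * (if k = j then 1 else 0) := by
  obtain ⟨R, hR, hRΩ⟩ := Metric.nhds_basis_closedBall.mem_iff.mp (hΩ.mem_nhds hp)
  let b : ContDiffBump p := ⟨R / 2, R, by positivity, by linarith⟩
  have hb : tsupport (fun y : Euc N => b y * y k ^ 2) ⊆ tsupport b := tsupport_mul_subset_left
  have hcomp : HasCompactSupport (fun y : Euc N => b y * y k ^ 2) := b.hasCompactSupport.mul_right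
  have hsmooth : ContDiff ℝ (⊤ : ℕ∞) (fun y : Euc N => b y * y k ^ 2) :=
    b.contDiff.mul ((EuclideanSpace.proj k : Euc N →L[ℝ] ℝ).contDiff.pow 2)
  refine ⟨fun y => b y * y k ^ 2, ⟨hsmooth, hcomp, ?_⟩, R / 2, by positivity,
    ?_, fun x hx i j => ?_⟩
  · exact hb.trans (b.tsupport_eq.trans_subset hRΩ)
  · exact (Metric.ball_subset_closedBall.trans
      (Metric.closedBall_subset_closedBall (by linarith))).trans hRΩ
  · have heq : (fun y : Euc N => b y * y k ^ 2) =ᶠ[𝓝 x] fun y => y k ^ 2 := by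
      filter_upwards [Metric.isOpen_ball.mem_nhds hx] with y hy
      rw [b.one_of_mem_closedBall (Metric.ball_subset_closedBall hy), one_mul]
    rw [← hessX_coord_sq k i j x, hessX, (heq.iteratedFDeriv ℝ 2).eq_of_nhds, hessX]

/-- `Qint` does not vanish identically on `L²(Ω; ℝ^N)`. -/
lemma exists_Qint_ne_zero {N : ℕ} (hN : 2 ≤ N) {Ω : Set (Euc N)} (hΩne : Ω.Nonempty)
    (hΩ : IsOpen Ω) :
    ∃ φ, IsTestFun Ω φ ∧ ∃ v : Lp (Euc N) 2 (volume.restrict Ω), Qint Ω (⇑v) φ ≠ 0 := by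
  obtain ⟨p, hp⟩ := hΩne
  let k : Fin N := ⟨0, by omega⟩
  obtain ⟨φ, hφ, ρ, hρ, hsub, hhess⟩ := exists_isTestFun_hessX_eq hΩ hp k
  have hfin : (volume.restrict Ω) (Metric.ball p ρ) ≠ ⊤ :=
    ((Measure.restrict_apply_le _ _).trans_lt measure_ball_lt_top).ne
  refine ⟨φ, hφ, indicatorConstLp 2 measurableSet_ball hfin (EuclideanSpace.single k 1), ?_⟩
  have hint : Qint Ω (⇑(indicatorConstLp 2 measurableSet_ball hfin
      (EuclideanSpace.single k (1 : ℝ)))) φ =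
      ∫ x in Ω, (Metric.ball p ρ).indicator (fun _ => 2 - 2 / (N : ℝ)) x := by
    refine integral_congr_ae ?_
    filter_upwards [indicatorConstLp_coeFn (p := 2) (hs := measurableSet_ball) (hμs := hfin)
      (c := EuclideanSpace.single k (1 : ℝ))] with x hx
    rw [hx]
    by_cases hxρ : x ∈ Metric.ball p ρ
    · simp only [indicator_of_mem hxρ, hhess x hxρ]
      simp
      ring
    · simp [indicator_of_notMem hxρ]
  have hN' : (2 : ℝ) ≤ N := by exact_mod_cast hN
  have hpos : (0 : ℝ) < 2 - 2 / (N : ℝ) := by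
    rw [sub_pos, div_lt_iff₀ (by linarith)]
    linarith
  rw [hint, integral_indicator_const _ measurableSet_ball, smul_eq_mul,
    measureReal_restrict_apply measurableSet_ball, inter_eq_self_of_subset_left hsub]
  exact mul_ne_zero (ENNReal.toReal_pos (Metric.measure_ball_pos volume p hρ).ne'
    measure_ball_lt_top.ne).ne' hpos.ne'

/-- For `Ω ⊂ ℝ^N` (`N = 2` or `3`) a nonempty bounded domain, the set
`S = { w ∈ L²(Ω;ℝ^N) : ∫_Ω [(w⊗w):∇²φ − (1/N)|w|²Δφ] dx = 0  ∀ φ ∈ C_c^∞(Ω) }`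
is nowhere dense in `L²(Ω;ℝ^N)`: its closure contains no open ball. -/
theorem Sset_nowhereDense {N : ℕ} (hN : N = 2 ∨ N = 3) (Ω : Set (Euc N))
    (hΩne : Ω.Nonempty) (hΩopen : IsOpen Ω) (hΩconn : IsConnected Ω)
    (hΩbdd : Bornology.IsBounded Ω) :
    ∀ (w₀ : Lp (Euc N) 2 (volume.restrict Ω)) (r : ℝ), 0 < r →
      ¬ Metric.ball w₀ r ⊆ closure (Sset Ω) := by
  intro w₀ r hr hball
  obtain ⟨φ, hφ, v, hv⟩ := exists_Qint_ne_zero (by omega : 2 ≤ N) hΩne hΩopen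
  obtain ⟨T, hT⟩ := exists_clm_Qint_eq_inner hφ
  exact hv ((hT v).trans (inner_self_eq_zero_of_ball_subset_closure T
    (fun w (hw : w ∈ Sset Ω) => (hT w).symm.trans (hw φ hφ)) hr hball v))
end
end

section
/- Let Ω ⊂ ℝ^N (N ≥ 2) be a nonempty bounded domain. Then S ≠ L²(Ω;ℝ^N): there exist w ∈ L²(Ω;ℝ^N) and φ ∈ C_c^∞(Ω) such that ∫_Ω [ (w ⊗ w) : ∇²φ − (1/N) |w|² Δφ ] dx ≠ 0, where S = { w ∈ L²(Ω;ℝ^N) : ∫_Ω [ (w ⊗ w) : ∇²φ − (1/N) |w|² Δφ ] dx = 0 for every φ ∈ C_c^∞(Ω) }. -/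
open MeasureTheory Set Filter Topology

noncomputable section

/-- The Hessian of `x ↦ (x k - c) ^ 2`. -/
theorem hessX_sq_coord_sub {N : ℕ} (k : Fin N) (c : ℝ) (x : Euc N) (i j : Fin N) :
    hessX (fun y : Euc N => (y k - c) ^ 2) x i j =
      2 * (if k = i then 1 else 0) * (if k = j then 1 else 0) := by
  let L : Euc N →L[ℝ] ℝ := EuclideanSpace.proj k
  have hL : ∀ y : Euc N, HasFDerivAt (fun z : Euc N => z k - c) L y := fun y =>
    L.hasFDerivAt.sub_const c
  have h1 : fderiv ℝ (fun y : Euc N => (y k - c) ^ 2) =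
      fun y : Euc N => (2 * (y k - c)) • L := by
    funext y
    simpa using ((hL y).pow 2).fderiv
  have h2 : HasFDerivAt (fun y : Euc N => (2 * (y k - c)) • L)
      (((2 : ℝ) • L).smulRight L) x :=
    ((hL x).const_mul 2).smul_const L
  rw [hessX, iteratedFDeriv_two_apply, h1, h2.fderiv]
  by_cases hi : k = i <;> simp [L, hi]

/-- Every open neighbourhood of `a` carries a test function which coincides near `a` with
`x ↦ (x k - a k) ^ 2`. -/
theorem exists_isTestFun_eq_sq_coord_sub {N : ℕ} {Ω : Set (Euc N)} (hΩ : IsOpen Ω)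
    {a : Euc N} (ha : a ∈ Ω) (k : Fin N) :
    ∃ φ : Euc N → ℝ, IsTestFun Ω φ ∧ ∃ r > 0, Metric.ball a r ⊆ Ω ∧
      ∀ x ∈ Metric.ball a r, φ x = (x k - a k) ^ 2 := by
  obtain ⟨R, hR, hRΩ⟩ := Metric.isOpen_iff.1 hΩ a ha
  let χ : ContDiffBump a := ⟨R / 4, R / 2, by positivity, by linarith⟩
  refine ⟨fun x => χ x * (x k - a k) ^ 2, ⟨?_, ?_, ?_⟩, R / 4, by positivity, ?_, ?_⟩
  · exact χ.contDiff.mul (by fun_prop)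
  · exact χ.hasCompactSupport.mul_right
  · refine (tsupport_mul_subset_left (f := fun x => χ x)).trans ?_
    rw [χ.tsupport_eq]
    exact (Metric.closedBall_subset_ball (by change R / 2 < R; linarith)).trans hRΩ
  · exact (Metric.ball_subset_ball (by linarith)).trans hRΩ
  · intro x hx
    simp [χ.one_of_mem_closedBall (Metric.ball_subset_closedBall hx)]

/-- For `Ω ⊂ ℝ^N` (`N ≥ 2`) a nonempty bounded domain, `S ≠ L²(Ω;ℝ^N)`:
there exist `w ∈ L²(Ω;ℝ^N)` and `φ ∈ C_c^∞(Ω)` with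
`∫_Ω [(w⊗w):∇²φ − (1/N)|w|²Δφ] dx ≠ 0`. -/
theorem Sset_ne_univ {N : ℕ} (hN : 2 ≤ N) (Ω : Set (Euc N))
    (hΩne : Ω.Nonempty) (hΩopen : IsOpen Ω) (hΩconn : IsConnected Ω)
    (hΩbdd : Bornology.IsBounded Ω) :
    Sset Ω ≠ Set.univ ∧
      ∃ (w : Lp (Euc N) 2 (volume.restrict Ω)) (φ : Euc N → ℝ),
        IsTestFun Ω φ ∧ Qint Ω (⇑w) φ ≠ 0 := by
  suffices h : ∃ (w : Lp (Euc N) 2 (volume.restrict Ω)) (φ : Euc N → ℝ),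
      IsTestFun Ω φ ∧ Qint Ω (⇑w) φ ≠ 0 by
    refine ⟨fun hS => ?_, h⟩
    obtain ⟨w, φ, hφ, hw⟩ := h
    exact hw ((hS ▸ Set.mem_univ w : w ∈ Sset Ω) φ hφ)
  obtain ⟨a, ha⟩ := hΩne
  let k : Fin N := ⟨0, by omega⟩
  obtain ⟨φ, hφ, r, hr, hrΩ, hφeq⟩ := exists_isTestFun_eq_sq_coord_sub hΩopen ha k
  have hess : ∀ x ∈ Metric.ball a r, ∀ i j, hessX φ x i j =
      2 * (if k = i then 1 else 0) * (if k = j then 1 else 0) := by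
    intro x hx i j
    have hev : φ =ᶠ[𝓝 x] fun y : Euc N => (y k - a k) ^ 2 :=
      Filter.eventually_of_mem (Metric.isOpen_ball.mem_nhds hx) hφeq
    rw [← hessX_sq_coord_sub k (a k) x i j, hessX, hessX, (Filter.EventuallyEq.iteratedFDeriv ℝ hev 2).eq_of_nhds]
  have hfin : (volume.restrict Ω) (Metric.ball a r) ≠ ⊤ :=
    ((Measure.restrict_apply_le _ _).trans_lt measure_ball_lt_top).ne
  refine ⟨indicatorConstLp 2 measurableSet_ball hfin (EuclideanSpace.single k 1), φ, hφ, ?_⟩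
  have key : Qint Ω (indicatorConstLp 2 measurableSet_ball hfin
      (EuclideanSpace.single k (1 : ℝ))) φ =
      ∫ x in Ω, (Metric.ball a r).indicator (fun _ => 2 - 2 / (N : ℝ)) x := by
    refine integral_congr_ae ?_
    filter_upwards [indicatorConstLp_coeFn (p := 2) (hs := measurableSet_ball) (hμs := hfin)
      (c := EuclideanSpace.single k (1 : ℝ))] with x hx
    rw [hx]
    by_cases hxb : x ∈ Metric.ball a r
    · simp only [Set.indicator_of_mem hxb, hess x hxb]
      simp
      ring
    · simp [Set.indicator_of_notMem hxb]
  rw [key, integral_indicator measurableSet_ball, Measure.restrict_restrict measurableSet_ball,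
    Set.inter_eq_left.2 hrΩ, setIntegral_const, smul_eq_mul]
  have hN' : (2 : ℝ) ≤ N := by exact_mod_cast hN
  have hdiv : 2 / (N : ℝ) ≤ 1 := (div_le_one (by linarith)).2 hN'
  have hvol : 0 < volume.real (Metric.ball a r) :=
    ENNReal.toReal_pos (Metric.measure_ball_pos volume a hr).ne' measure_ball_lt_top.ne
  exact (mul_pos hvol (by linarith)).ne'
end
end
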